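/- arXiv:2401.08437 — 2 statements merged into one kernel-verified Lean document; each statement's English description precedes it below -/
import Mathlib

section
/- Let λ ∈ ℤ^D \ {0} and let ψ_∞, φ̃_∞ be arbitrary real numbers. Then there exists a λ-mode wave solution (φ, ψ) on (0, t_{λ*}] such that ψ(t) → ψ_∞ and φ̃(t) → φ̃_∞ as t → 0⁺; it is the unique λ-mode wave solution on (0, t_{λ*}] attaining these limits; it satisfies the rate bound |ψ(t) − ψ_∞| + |φ̃(t) − φ̃_∞| ≤ C·τ_λ(t)²·(1 + log(t_{λ*}/t)²)·E_{λ,low}(t_{λ*})^{1/2} for all t ∈ (0, t_{λ*}] with C depending only on D and p_1,…,p_D; and E_{λ,low}(t_{λ*}) ≤ C_low·(ψ_∞² + φ̃_∞²), where C_low depends only on D and p_1,…,p_D. -/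
open Real Filter MeasureTheory Topology

/-- τ_λ(t) = (∑ᵢ t^(2-2pᵢ) λᵢ²)^(1/2). -/
noncomputable def tau {D : ℕ} (p : Fin D → ℝ) (lam : Fin D → ℤ) (t : ℝ) : ℝ :=
  Real.sqrt (∑ i, t ^ (2 - 2 * p i) * ((lam i : ℝ)) ^ 2)

/-- A λ-mode wave solution on the set `I`: t φ' = ψ and t ψ' = -τ_λ(t)² φ. -/
def IsWaveSol {D : ℕ} (p : Fin D → ℝ) (lam : Fin D → ℤ) (φ ψ : ℝ → ℝ) (I : Set ℝ) : Prop :=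
  ∀ t ∈ I, HasDerivAt φ (ψ t / t) t ∧ HasDerivAt ψ (-(tau p lam t ^ 2) * φ t / t) t

/-- The renormalized field φ̃(t) = φ(t) - ψ(t) log(t/t_{λ*}). -/
noncomputable def phiTilde (φ ψ : ℝ → ℝ) (tstar t : ℝ) : ℝ :=
  φ t - ψ t * Real.log (t / tstar)

/-- The low-frequency wave energy E_{λ,low}(t) = ψ(t)² + φ̃(t)². -/
noncomputable def Elow (φ ψ : ℝ → ℝ) (tstar t : ℝ) : ℝ :=
  ψ t ^ 2 + phiTilde φ ψ tstar t ^ 2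

/-- The linear initial value problem `x' = A(t) x`, `x(0) = x₀` on `[0, b]` has a solution. -/
theorem exists_hasDerivWithinAt_linear_prod {A : ℝ → ℝ × ℝ →L[ℝ] ℝ × ℝ} (hA : Continuous A)
    {b : ℝ} (hb : 0 ≤ b) (x₀ : ℝ × ℝ) :
    ∃ X : ℝ → ℝ × ℝ, X 0 = x₀ ∧
      ∀ t ∈ Set.Icc 0 b, HasDerivWithinAt X (A t (X t)) (Set.Icc 0 b) t := by
  obtain ⟨K, hK⟩ := (isCompact_Icc (a := (0 : ℝ)) (b := b)).exists_bound_of_continuousOn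
    hA.continuousOn
  have hK0 : 0 ≤ K := (norm_nonneg _).trans (hK 0 ⟨le_rfl, hb⟩)
  set R : ℝ := ‖x₀‖ * exp (K * b)
  have hR0 : 0 ≤ R := by positivity
  -- Truncate to a bounded field, which agrees with the linear one on a large enough ball.
  let clamp : ℝ → ℝ := fun y ↦ max (min y R) (-R)
  have hclampR (y : ℝ) : |clamp y| ≤ R :=
    abs_le.2 ⟨le_max_right _ _, max_le (min_le_right _ _) (by linarith)⟩
  have hclamp_abs (y : ℝ) : |clamp y| ≤ |y| := by
    rcases abs_cases y with ⟨h, h'⟩ | ⟨h, h'⟩ <;> rw [h, abs_le] <;>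
      simp only [clamp, le_max_iff, max_le_iff, le_min_iff, min_le_iff] <;> grind
  have hclamp_eq {y : ℝ} (hy : |y| ≤ R) : clamp y = y := by
    rw [abs_le] at hy
    simp only [clamp, min_eq_left hy.2, max_eq_left hy.1]
  have hclamp_lip : LipschitzWith 1 clamp := (LipschitzWith.id.min_const R).max_const (-R)
  let ρ : ℝ × ℝ → ℝ × ℝ := fun x ↦ (clamp x.1, clamp x.2)
  have hρ_lip : LipschitzWith 1 ρ := by
    have h := (hclamp_lip.comp LipschitzWith.prod_fst).prodMk
      (hclamp_lip.comp LipschitzWith.prod_snd)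
    simpa using h
  have hρR (x : ℝ × ℝ) : ‖ρ x‖ ≤ R := by
    simpa [Prod.norm_def, ρ] using ⟨hclampR x.1, hclampR x.2⟩
  have hρ_norm (x : ℝ × ℝ) : ‖ρ x‖ ≤ ‖x‖ := by
    simp only [Prod.norm_def, ρ, norm_eq_abs]
    exact max_le_max (hclamp_abs _) (hclamp_abs _)
  have hPL : IsPicardLindelof (fun t x ↦ A t (ρ x)) (tmin := 0) (tmax := b) ⟨0, le_rfl, hb⟩ x₀
      (K * R * b).toNNReal 0 (K * R).toNNReal K.toNNReal := by
    refine ⟨fun t ht ↦ ?_, fun x _ ↦ ?_, fun t ht x _ ↦ ?_, ?_⟩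
    · refine LipschitzOnWith.of_dist_le_mul fun x _ y _ ↦ ?_
      rw [dist_eq_norm, ← map_sub, coe_toNNReal _ hK0]
      refine ((A t).le_opNorm _).trans (mul_le_mul (hK t ht) ?_ (norm_nonneg _) hK0)
      simpa [dist_eq_norm] using hρ_lip.dist_le_mul x y
    · exact (hA.clm_apply continuous_const).continuousOn
    · rw [coe_toNNReal _ (by positivity)]
      exact ((A t).le_opNorm _).trans (mul_le_mul (hK t ht) (hρR x) (norm_nonneg _) hK0)
    · rw [coe_toNNReal _ (by positivity), coe_toNNReal _ (by positivity)]
      simp [hb]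
  obtain ⟨X, hX0, hX⟩ := hPL.exists_eq_forall_mem_Icc_hasDerivWithinAt₀
  refine ⟨X, hX0, fun t ht ↦ ?_⟩
  have hbound : ‖X t‖ ≤ R := by
    have h := norm_le_gronwallBound_of_norm_deriv_right_le (δ := ‖x₀‖) (K := K) (ε := 0)
      (fun s hs ↦ (hX s hs).continuousWithinAt)
      (fun s hs ↦ (hX s ⟨hs.1, hs.2.le⟩).mono_of_mem_nhdsWithin (Icc_mem_nhdsGE_of_mem hs))
      (by simp [hX0])
      (fun s hs ↦ by
        rw [add_zero]
        exact ((A s).le_opNorm _).trans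
          (mul_le_mul (hK s ⟨hs.1, hs.2.le⟩) (hρ_norm _) (norm_nonneg _) hK0)) t ht
    rw [gronwallBound_ε0, sub_zero] at h
    exact h.trans (mul_le_mul_of_nonneg_left
      (exp_le_exp.2 (mul_le_mul_of_nonneg_left ht.2 hK0)) (norm_nonneg _))
  have hρX : ρ (X t) = X t := by
    rw [Prod.norm_def, sup_le_iff] at hbound
    exact Prod.ext (hclamp_eq hbound.1) (hclamp_eq hbound.2)
  simpa only [hρX] using hX t ht

theorem monotoneOn_Ioc_of_hasDerivAt_nonneg {f f' : ℝ → ℝ} {T : ℝ}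
    (hf : ∀ t ∈ Set.Ioc 0 T, HasDerivAt f (f' t) t) (hf' : ∀ t ∈ Set.Ioc 0 T, 0 ≤ f' t) :
    MonotoneOn f (Set.Ioc 0 T) := by
  refine monotoneOn_of_hasDerivWithinAt_nonneg (f' := f') (convex_Ioc 0 T)
    (fun t ht ↦ (hf t ht).continuousAt.continuousWithinAt) (fun t ht ↦ ?_) (fun t ht ↦ ?_)
  · exact (hf t (interior_subset ht)).hasDerivWithinAt
  · exact hf' t (interior_subset ht)

theorem MonotoneOn.le_of_tendsto_nhdsGT {f : ℝ → ℝ} {T l t : ℝ}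
    (hf : MonotoneOn f (Set.Ioc 0 T)) (hl : Tendsto f (𝓝[>] 0) (𝓝 l)) (ht : t ∈ Set.Ioc 0 T) :
    l ≤ f t := by
  refine le_of_tendsto hl ?_
  filter_upwards [Ioc_mem_nhdsGT ht.1] with s hs
  exact hf ⟨hs.1, hs.2.trans ht.2⟩ ht hs.2

theorem abs_sub_le_of_abs_hasDerivAt_le {f f' B B' : ℝ → ℝ} {T l S t : ℝ}
    (hf : ∀ t ∈ Set.Ioc 0 T, HasDerivAt f (f' t) t)
    (hB : ∀ t ∈ Set.Ioc 0 T, HasDerivAt B (B' t) t)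
    (hle : ∀ t ∈ Set.Ioc 0 T, |f' t| ≤ S * B' t)
    (hl : Tendsto f (𝓝[>] 0) (𝓝 l)) (hB0 : Tendsto B (𝓝[>] 0) (𝓝 0)) (ht : t ∈ Set.Ioc 0 T) :
    |f t - l| ≤ S * B t := by
  have h₁ := (monotoneOn_Ioc_of_hasDerivAt_nonneg
    (fun s hs ↦ ((hB s hs).const_mul S).sub (hf s hs))
    (fun s hs ↦ sub_nonneg.2 (abs_le.1 (hle s hs)).2)).le_of_tendsto_nhdsGT
      ((hB0.const_mul S).sub hl) ht
  have h₂ := (monotoneOn_Ioc_of_hasDerivAt_nonneg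
    (fun s hs ↦ ((hB s hs).const_mul S).add (hf s hs))
    (fun s hs ↦ by linarith [(abs_le.1 (hle s hs)).1])).le_of_tendsto_nhdsGT
      ((hB0.const_mul S).add hl) ht
  simp only [Pi.sub_apply, Pi.add_apply, mul_zero] at h₁ h₂
  rw [abs_le]
  constructor <;> linarith

section Wave

variable {D : ℕ} {p : Fin D → ℝ} {lam : Fin D → ℤ} {m T : ℝ} {φ ψ φ₁ ψ₁ : ℝ → ℝ}

theorem tau_sq {t : ℝ} (ht : 0 ≤ t) :
    tau p lam t ^ 2 = ∑ i, t ^ (2 - 2 * p i) * (lam i : ℝ) ^ 2 :=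
  sq_sqrt (Finset.sum_nonneg fun _ _ ↦ by positivity)

theorem hasDerivAt_tau_sq {t : ℝ} (ht : 0 < t) :
    HasDerivAt (fun t ↦ tau p lam t ^ 2)
      (∑ i, (2 - 2 * p i) * t ^ (2 - 2 * p i - 1) * (lam i : ℝ) ^ 2) t := by
  refine HasDerivAt.congr_of_eventuallyEq (HasDerivAt.fun_sum fun i _ ↦
    (hasDerivAt_rpow_const (Or.inl ht.ne')).mul_const _) ?_
  filter_upwards [lt_mem_nhds ht] with s hs using tau_sq hs.le

theorem tendsto_rpow_mul_log_div_nhdsGT_zero {a : ℝ} (ha : 0 < a) (hT : 0 < T) :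
    Tendsto (fun t ↦ t ^ a * log (t / T)) (𝓝[>] 0) (𝓝 0) := by
  have h₁ : Tendsto (fun t : ℝ ↦ t ^ a) (𝓝[>] 0) (𝓝 0) := by
    simpa [zero_rpow ha.ne'] using
      ((continuous_rpow_const ha.le).tendsto 0).mono_left nhdsWithin_le_nhds
  have h := (tendsto_log_mul_rpow_nhdsGT_zero ha).sub (h₁.mul_const (log T))
  rw [zero_mul, sub_zero] at h
  refine h.congr' ?_
  filter_upwards [self_mem_nhdsWithin] with t (ht : 0 < t)
  rw [log_div ht.ne' hT.ne']
  ring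

theorem hasDerivAt_log_div (hT : 0 < T) {t : ℝ} (ht : 0 < t) :
    HasDerivAt (fun t ↦ log (t / T)) (1 / t) t := by
  refine (((hasDerivAt_id t).div_const T).log (div_ne_zero ht.ne' hT.ne')).congr_deriv ?_
  simp only [id]
  field_simp

/-- A primitive majorant of the coefficient size `τ_λ(t)² (1 + log(t/T)²) / t`. -/
noncomputable def lowWeight (p : Fin D → ℝ) (lam : Fin D → ℤ) (m T t : ℝ) : ℝ :=
  2 / m * (tau p lam t ^ 2 * (log (t / T) ^ 2 + (2 / m ^ 2 + 1 / 2)))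

theorem tendsto_lowWeight (hp : ∀ i, p i < 1) (hT : 0 < T) :
    Tendsto (lowWeight p lam m T) (𝓝[>] 0) (𝓝 0) := by
  have h (i : Fin D) : Tendsto (fun t : ℝ ↦ t ^ (2 - 2 * p i) * (lam i : ℝ) ^ 2 *
      (log (t / T) ^ 2 + (2 / m ^ 2 + 1 / 2))) (𝓝[>] 0) (𝓝 0) := by
    have ha : 0 < 2 - 2 * p i := by linarith [hp i]
    have h₁ : Tendsto (fun t : ℝ ↦ t ^ (2 - 2 * p i)) (𝓝[>] 0) (𝓝 0) := by
      simpa [zero_rpow ha.ne'] using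
        ((continuous_rpow_const ha.le).tendsto 0).mono_left nhdsWithin_le_nhds
    have h₂ := (tendsto_rpow_mul_log_div_nhdsGT_zero (half_pos ha) hT).pow 2
    have h₃ := (h₂.add (h₁.mul_const (2 / m ^ 2 + 1 / 2))).const_mul ((lam i : ℝ) ^ 2)
    simp only [zero_mul, mul_zero, add_zero, ne_eq, OfNat.ofNat_ne_zero, not_false_eq_true,
      zero_pow] at h₃
    refine h₃.congr' ?_
    filter_upwards [self_mem_nhdsWithin] with t (ht : 0 < t)
    rw [mul_pow, ← rpow_mul_natCast ht.le, Nat.cast_ofNat, div_mul_cancel₀ _ two_ne_zero]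
    ring
  have hs := (tendsto_finsetSum Finset.univ fun i _ ↦ h i).const_mul (2 / m)
  simp only [Finset.sum_const_zero, mul_zero] at hs
  refine hs.congr' ?_
  filter_upwards [self_mem_nhdsWithin] with t (ht : 0 < t)
  rw [lowWeight, tau_sq ht.le, Finset.sum_mul]

theorem exists_hasDerivAt_lowWeight (hm : 0 < m) (hmp : ∀ i, m ≤ 2 - 2 * p i) (hT : 0 < T) :
    ∃ B' : ℝ → ℝ, ∀ t ∈ Set.Ioc 0 T, HasDerivAt (lowWeight p lam m T) (B' t) t ∧
      tau p lam t ^ 2 * (1 + log (t / T) ^ 2) / t ≤ B' t := by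
  refine ⟨fun t ↦ 2 / m * ((∑ i, (2 - 2 * p i) * t ^ (2 - 2 * p i - 1) * (lam i : ℝ) ^ 2) *
    (log (t / T) ^ 2 + (2 / m ^ 2 + 1 / 2)) + tau p lam t ^ 2 * (2 * log (t / T) / t)),
    fun t ht ↦ ⟨?_, ?_⟩⟩
  · have hlog : HasDerivAt (fun t ↦ log (t / T) ^ 2 + (2 / m ^ 2 + 1 / 2))
        (2 * log (t / T) / t) t := by
      refine (((hasDerivAt_log_div hT ht.1).pow 2).add_const _).congr_deriv ?_
      push_cast
      ring
    exact ((hasDerivAt_tau_sq ht.1).mul hlog).const_mul _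
  · have hτ : m * tau p lam t ^ 2 / t ≤
        ∑ i, (2 - 2 * p i) * t ^ (2 - 2 * p i - 1) * (lam i : ℝ) ^ 2 := by
      rw [tau_sq ht.1.le, Finset.mul_sum, Finset.sum_div]
      refine Finset.sum_le_sum fun i _ ↦ ?_
      rw [rpow_sub_one ht.1.ne']
      calc m * (t ^ (2 - 2 * p i) * (lam i : ℝ) ^ 2) / t
          = m * (t ^ (2 - 2 * p i) / t) * (lam i : ℝ) ^ 2 := by ring
        _ ≤ _ := by
          have := ht.1
          gcongr
          exact hmp i
    set L := log (t / T)
    have hpoly : m / 2 * (1 + L ^ 2) ≤ m * (L ^ 2 + (2 / m ^ 2 + 1 / 2)) + 2 * L := by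
      have h : m * (L ^ 2 + (2 / m ^ 2 + 1 / 2)) + 2 * L - m / 2 * (1 + L ^ 2) =
          m / 2 * (L + 2 / m) ^ 2 := by
        field_simp
        ring
      have : 0 ≤ m / 2 * (L + 2 / m) ^ 2 := by positivity
      linarith
    have ht0 := ht.1
    calc tau p lam t ^ 2 * (1 + L ^ 2) / t
        = 2 / m * (tau p lam t ^ 2 / t * (m / 2 * (1 + L ^ 2))) := by field_simp
      _ ≤ 2 / m * (tau p lam t ^ 2 / t * (m * (L ^ 2 + (2 / m ^ 2 + 1 / 2)) + 2 * L)) := by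
        gcongr
      _ = 2 / m * (m * tau p lam t ^ 2 / t * (L ^ 2 + (2 / m ^ 2 + 1 / 2)) +
          tau p lam t ^ 2 * (2 * L / t)) := by ring
      _ ≤ _ := mul_le_mul_of_nonneg_left (add_le_add
        (mul_le_mul_of_nonneg_right hτ (by positivity)) le_rfl) (by positivity)

theorem IsWaveSol.hasDerivAt_phiTilde {I : Set ℝ} (h : IsWaveSol p lam φ ψ I) (hT : 0 < T)
    {t : ℝ} (ht : 0 < t) (htI : t ∈ I) :
    HasDerivAt (phiTilde φ ψ T) (tau p lam t ^ 2 * φ t * log (t / T) / t) t := by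
  refine ((h t htI).1.sub ((h t htI).2.mul (hasDerivAt_log_div hT ht))).congr_deriv ?_
  ring

theorem phi_eq_phiTilde_add (φ ψ : ℝ → ℝ) (T t : ℝ) :
    φ t = phiTilde φ ψ T t + ψ t * log (t / T) := by
  rw [phiTilde, sub_add_cancel]

theorem sq_phi_le (φ ψ : ℝ → ℝ) (T t : ℝ) :
    φ t ^ 2 ≤ (1 + log (t / T) ^ 2) * Elow φ ψ T t := by
  rw [phi_eq_phiTilde_add φ ψ T t, Elow]
  nlinarith [sq_nonneg (phiTilde φ ψ T t * log (t / T) - ψ t)]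

theorem IsWaveSol.exists_hasDerivAt_Elow {I : Set ℝ} (h : IsWaveSol p lam φ ψ I) (hT : 0 < T)
    {t : ℝ} (ht : 0 < t) (htI : t ∈ I) :
    ∃ E', HasDerivAt (Elow φ ψ T) E' t ∧
      |E'| ≤ 2 * (tau p lam t ^ 2 * (1 + log (t / T) ^ 2) / t) * Elow φ ψ T t := by
  refine ⟨_, ((h t htI).2.pow 2).add ((h.hasDerivAt_phiTilde hT ht htI).pow 2), ?_⟩
  rw [phi_eq_phiTilde_add φ ψ T t, Elow]
  set L := log (t / T)
  set u := ψ t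
  set v := phiTilde φ ψ T t
  have hkey : |(v + u * L) * (v * L - u)| ≤ (1 + L ^ 2) * (u ^ 2 + v ^ 2) := by
    rw [abs_le]
    constructor <;> nlinarith [sq_nonneg (v + u * L + (v * L - u)),
      sq_nonneg (v + u * L - (v * L - u)), sq_nonneg (v + u * L), sq_nonneg (v * L - u)]
  calc _ = |2 * (tau p lam t ^ 2 / t) * ((v + u * L) * (v * L - u))| := by
        congr 1
        push_cast
        ring
    _ = 2 * (tau p lam t ^ 2 / t) * |(v + u * L) * (v * L - u)| := by
        rw [abs_mul, abs_of_nonneg (by positivity)]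
    _ ≤ 2 * (tau p lam t ^ 2 / t) * ((1 + L ^ 2) * (u ^ 2 + v ^ 2)) := by gcongr
    _ = _ := by ring

theorem Elow_nonneg (φ ψ : ℝ → ℝ) (T t : ℝ) : 0 ≤ Elow φ ψ T t := by
  unfold Elow
  positivity

theorem IsWaveSol.monotoneOn_Elow_mul_exp (h : IsWaveSol p lam φ ψ (Set.Ioc 0 T)) (hT : 0 < T)
    (hm : 0 < m) (hmp : ∀ i, m ≤ 2 - 2 * p i) :
    MonotoneOn (fun t ↦ Elow φ ψ T t * exp (2 * lowWeight p lam m T t)) (Set.Ioc 0 T) ∧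
    MonotoneOn (fun t ↦ -(Elow φ ψ T t * exp (-(2 * lowWeight p lam m T t)))) (Set.Ioc 0 T) := by
  obtain ⟨B', hB'⟩ := exists_hasDerivAt_lowWeight (lam := lam) hm hmp hT
  have hE (t : ℝ) (ht : t ∈ Set.Ioc 0 T) : ∃ E', HasDerivAt (Elow φ ψ T) E' t ∧
      |E'| ≤ 2 * B' t * Elow φ ψ T t := by
    obtain ⟨E', hE', hle⟩ := h.exists_hasDerivAt_Elow hT ht.1 ht
    refine ⟨E', hE', hle.trans ?_⟩
    have := Elow_nonneg φ ψ T t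
    gcongr
    exact (hB' t ht).2
  choose! E' hE' hle using hE
  constructor
  · refine monotoneOn_Ioc_of_hasDerivAt_nonneg
      (fun t ht ↦ (hE' t ht).mul (((hB' t ht).1.const_mul 2).exp)) fun t ht ↦ ?_
    have h₁ := (abs_le.1 (hle t ht)).1
    have := mul_nonneg (exp_pos (2 * lowWeight p lam m T t)).le
      (show 0 ≤ E' t + 2 * B' t * Elow φ ψ T t by linarith)
    linarith
  · refine monotoneOn_Ioc_of_hasDerivAt_nonneg
      (fun t ht ↦ ((hE' t ht).mul (((hB' t ht).1.const_mul 2).neg.exp)).neg) fun t ht ↦ ?_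
    have h₁ := (abs_le.1 (hle t ht)).2
    have := mul_nonneg (exp_pos (-(2 * lowWeight p lam m T t))).le
      (show 0 ≤ 2 * B' t * Elow φ ψ T t - E' t by linarith)
    simp only [Pi.neg_apply] at this ⊢
    linarith

theorem IsWaveSol.Elow_le_of_tendsto (h : IsWaveSol p lam φ ψ (Set.Ioc 0 T)) (hT : 0 < T)
    (hm : 0 < m) (hmp : ∀ i, m ≤ 2 - 2 * p i) {a b t : ℝ}
    (ha : Tendsto ψ (𝓝[>] 0) (𝓝 a)) (hb : Tendsto (phiTilde φ ψ T) (𝓝[>] 0) (𝓝 b))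
    (ht : t ∈ Set.Ioc 0 T) :
    Elow φ ψ T t ≤ exp (2 * lowWeight p lam m T t) * (a ^ 2 + b ^ 2) := by
  have hp (i : Fin D) : p i < 1 := by linarith [hmp i]
  have hE : Tendsto (Elow φ ψ T) (𝓝[>] 0) (𝓝 (a ^ 2 + b ^ 2)) := (ha.pow 2).add (hb.pow 2)
  have hexp : Tendsto (fun t ↦ exp (-(2 * lowWeight p lam m T t))) (𝓝[>] 0) (𝓝 1) := by
    have := ((tendsto_lowWeight (lam := lam) (m := m) hp hT).const_mul 2).neg
    rw [mul_zero, neg_zero] at this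
    simpa [Function.comp_def] using (continuous_exp.tendsto 0).comp this
  have h₁ := (h.monotoneOn_Elow_mul_exp hT hm hmp).2.le_of_tendsto_nhdsGT (hE.mul hexp).neg ht
  rw [mul_one, neg_le_neg_iff, exp_neg, ← div_eq_mul_inv, div_le_iff₀ (exp_pos _)] at h₁
  linarith

theorem IsWaveSol.abs_sub_le_of_tendsto (h : IsWaveSol p lam φ ψ (Set.Ioc 0 T)) (hT : 0 < T)
    (hm : 0 < m) (hmp : ∀ i, m ≤ 2 - 2 * p i) {a b t : ℝ}
    (ha : Tendsto ψ (𝓝[>] 0) (𝓝 a)) (hb : Tendsto (phiTilde φ ψ T) (𝓝[>] 0) (𝓝 b))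
    (ht : t ∈ Set.Ioc 0 T) :
    |ψ t - a| + |phiTilde φ ψ T t - b| ≤
      2 * (√(Elow φ ψ T T * exp (2 * lowWeight p lam m T T)) * lowWeight p lam m T t) := by
  have hp (i : Fin D) : p i < 1 := by linarith [hmp i]
  obtain ⟨B', hB'⟩ := exists_hasDerivAt_lowWeight (lam := lam) hm hmp hT
  set S := √(Elow φ ψ T T * exp (2 * lowWeight p lam m T T))
  have hES (s : ℝ) (hs : s ∈ Set.Ioc 0 T) : √(Elow φ ψ T s) ≤ S := by
    refine sqrt_le_sqrt ?_
    have h₁ := (h.monotoneOn_Elow_mul_exp hT hm hmp).1 hs ⟨hT, le_rfl⟩ hs.2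
    refine le_trans (le_mul_of_one_le_right (Elow_nonneg ..) (one_le_exp ?_)) h₁
    unfold lowWeight
    positivity
  have hφ (s : ℝ) (hs : s ∈ Set.Ioc 0 T) :
      |φ s| ≤ (1 + log (s / T) ^ 2) * S ∧ |φ s * log (s / T)| ≤ (1 + log (s / T) ^ 2) * S := by
    have h₁ := sq_phi_le φ ψ T s
    have hE0 := Elow_nonneg φ ψ T s
    set L := log (s / T)
    have hL : 0 ≤ L ^ 2 := sq_nonneg L
    have h₂ : (1 + L ^ 2) * √(Elow φ ψ T s) ≤ (1 + L ^ 2) * S := by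
      gcongr
      exact hES s hs
    constructor <;> refine (abs_le_of_sq_le_sq ?_ (by positivity)).trans h₂ <;>
      rw [mul_pow (1 + L ^ 2), sq_sqrt hE0]
    · nlinarith [mul_nonneg hL hE0, mul_nonneg (mul_nonneg hL hL) hE0]
    · rw [mul_pow]
      nlinarith [mul_nonneg hL hE0, mul_nonneg (mul_nonneg hL hL) hE0,
        mul_le_mul_of_nonneg_right h₁ hL]
  have hbound (s : ℝ) (hs : s ∈ Set.Ioc 0 T) {y : ℝ} (hy : |y| ≤ (1 + log (s / T) ^ 2) * S) :
      tau p lam s ^ 2 / s * |y| ≤ S * B' s := by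
    have hs0 := hs.1
    calc tau p lam s ^ 2 / s * |y|
        ≤ tau p lam s ^ 2 / s * ((1 + log (s / T) ^ 2) * S) := by gcongr
      _ = S * (tau p lam s ^ 2 * (1 + log (s / T) ^ 2) / s) := by ring
      _ ≤ S * B' s := mul_le_mul_of_nonneg_left (hB' s hs).2 (sqrt_nonneg _)
  have hB0 := tendsto_lowWeight (lam := lam) (m := m) hp hT
  have h₁ := abs_sub_le_of_abs_hasDerivAt_le (fun s hs ↦ (h s hs).2) (fun s hs ↦ (hB' s hs).1)
    (S := S) (fun s hs ↦ by
      refine le_of_eq_of_le ?_ (hbound s hs (hφ s hs).1)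
      rw [neg_mul, neg_div, abs_neg, mul_div_right_comm, abs_mul,
        abs_of_nonneg (div_nonneg (sq_nonneg _) hs.1.le)]) ha hB0 ht
  have h₂ := abs_sub_le_of_abs_hasDerivAt_le (fun s hs ↦ h.hasDerivAt_phiTilde hT hs.1 hs)
    (fun s hs ↦ (hB' s hs).1) (S := S) (fun s hs ↦ by
      refine le_of_eq_of_le ?_ (hbound s hs (hφ s hs).2)
      rw [mul_assoc, mul_div_right_comm, abs_mul,
        abs_of_nonneg (div_nonneg (sq_nonneg _) hs.1.le)]) hb hB0 ht
  linarith

theorem IsWaveSol.sub {I : Set ℝ} (h : IsWaveSol p lam φ ψ I) (h₁ : IsWaveSol p lam φ₁ ψ₁ I) :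
    IsWaveSol p lam (φ - φ₁) (ψ - ψ₁) I := by
  refine fun t ht ↦ ⟨((h t ht).1.sub (h₁ t ht).1).congr_deriv ?_,
    ((h t ht).2.sub (h₁ t ht).2).congr_deriv ?_⟩ <;> simp only [Pi.sub_apply] <;> ring

theorem IsWaveSol.eq_of_tendsto (h : IsWaveSol p lam φ ψ (Set.Ioc 0 T))
    (h₁ : IsWaveSol p lam φ₁ ψ₁ (Set.Ioc 0 T)) (hT : 0 < T)
    (hm : 0 < m) (hmp : ∀ i, m ≤ 2 - 2 * p i) {a b t : ℝ}
    (ha : Tendsto ψ (𝓝[>] 0) (𝓝 a)) (hb : Tendsto (phiTilde φ ψ T) (𝓝[>] 0) (𝓝 b))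
    (ha₁ : Tendsto ψ₁ (𝓝[>] 0) (𝓝 a)) (hb₁ : Tendsto (phiTilde φ₁ ψ₁ T) (𝓝[>] 0) (𝓝 b))
    (ht : t ∈ Set.Ioc 0 T) : φ t = φ₁ t ∧ ψ t = ψ₁ t := by
  have hsub : phiTilde (φ - φ₁) (ψ - ψ₁) T = phiTilde φ ψ T - phiTilde φ₁ ψ₁ T := by
    ext s
    simp only [phiTilde, Pi.sub_apply]
    ring
  have h₂ := (h.sub h₁).Elow_le_of_tendsto hT hm hmp (ha.sub ha₁)
    (by rw [hsub]; exact hb.sub hb₁) ht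
  rw [sub_self, sub_self, zero_pow two_ne_zero, add_zero, mul_zero, Elow] at h₂
  have hψ : (ψ - ψ₁) t = 0 := by
    rw [← sq_eq_zero_iff]
    nlinarith [sq_nonneg ((ψ - ψ₁) t), sq_nonneg (phiTilde (φ - φ₁) (ψ - ψ₁) T t)]
  have hφ : phiTilde (φ - φ₁) (ψ - ψ₁) T t = 0 := by
    rw [← sq_eq_zero_iff]
    nlinarith [sq_nonneg ((ψ - ψ₁) t), sq_nonneg (phiTilde (φ - φ₁) (ψ - ψ₁) T t)]
  rw [phiTilde, hψ, zero_mul, sub_zero, Pi.sub_apply] at hφ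
  exact ⟨sub_eq_zero.1 hφ, sub_eq_zero.1 hψ⟩

theorem exists_isWaveSol_tendsto (hT : 0 < T) (hm : 0 < m) (hmp : ∀ i, m ≤ 2 - 2 * p i)
    (a b : ℝ) :
    ∃ φ ψ : ℝ → ℝ, IsWaveSol p lam φ ψ (Set.Ioc 0 T) ∧
      Tendsto ψ (𝓝[>] 0) (𝓝 a) ∧ Tendsto (phiTilde φ ψ T) (𝓝[>] 0) (𝓝 b) := by
  -- In the variable `r = (t / T) ^ (1 / k)` the renormalized system extends continuously to `0`.
  set k : ℝ := 4 / m
  have hk : 0 < k := by positivity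
  have hkp (i : Fin D) : 0 ≤ k * (2 - 2 * p i) - 3 := by
    have : k * m = 4 := div_mul_cancel₀ _ hm.ne'
    nlinarith [mul_le_mul_of_nonneg_left (hmp i) hk.le]
  let P : ℝ → ℝ := fun r ↦
    k * ∑ i, T ^ (2 - 2 * p i) * r ^ (k * (2 - 2 * p i) - 3) * (lam i : ℝ) ^ 2
  have hP : Continuous P := continuous_const.mul <| continuous_finsetSum _ fun i _ ↦
    (continuous_const.mul (continuous_rpow_const (hkp i))).mul continuous_const
  let G : ℝ → ℝ := fun r ↦ k * (r * log r)
  have hG : Continuous G := continuous_const.mul continuous_mul_log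
  let F : ℝ × ℝ →L[ℝ] ℝ := ContinuousLinearMap.fst ℝ ℝ ℝ
  let S : ℝ × ℝ →L[ℝ] ℝ := ContinuousLinearMap.snd ℝ ℝ ℝ
  let A : ℝ → ℝ × ℝ →L[ℝ] ℝ × ℝ := fun r ↦
    (-(P r * r)) • (ContinuousLinearMap.inl ℝ ℝ ℝ ∘L (r • S + G r • F)) +
    (P r * G r) • (ContinuousLinearMap.inr ℝ ℝ ℝ ∘L (r • S + G r • F))
  have hA : Continuous A := by fun_prop
  obtain ⟨X, hX0, hX⟩ := exists_hasDerivWithinAt_linear_prod hA zero_le_two (a, b)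
  let r : ℝ → ℝ := fun t ↦ (t / T) ^ k⁻¹
  have hr0 : Tendsto r (𝓝[>] 0) (𝓝[Set.Icc 0 2] 0) := by
    refine tendsto_nhdsWithin_iff.2 ⟨?_, ?_⟩
    · have h : Continuous r :=
        (continuous_rpow_const (by positivity)).comp (continuous_id.div_const T)
      have h0 : r 0 = 0 := by simp [r, zero_rpow (inv_pos.2 hk).ne']
      exact (h0 ▸ h.tendsto 0).mono_left nhdsWithin_le_nhds
    · filter_upwards [Ioc_mem_nhdsGT hT] with t ht
      refine ⟨rpow_nonneg (div_nonneg ht.1.le hT.le) _, ?_⟩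
      exact (rpow_le_one (div_nonneg ht.1.le hT.le) ((div_le_one hT).2 ht.2) (by positivity)).trans
        one_le_two
  have hlim : Tendsto (fun t ↦ X (r t)) (𝓝[>] 0) (𝓝 (a, b)) := by
    have h := (hX 0 ⟨le_rfl, zero_le_two⟩).continuousWithinAt.tendsto.comp hr0
    rwa [hX0] at h
  have htilde : phiTilde (fun t ↦ (X (r t)).2 + (X (r t)).1 * log (t / T))
      (fun t ↦ (X (r t)).1) T = fun t ↦ (X (r t)).2 := by
    ext t
    rw [phiTilde, add_sub_cancel_right]
  refine ⟨fun t ↦ (X (r t)).2 + (X (r t)).1 * log (t / T), fun t ↦ (X (r t)).1, fun t ht ↦ ?_,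
    (continuous_fst.tendsto _).comp hlim, htilde ▸ (continuous_snd.tendsto _).comp hlim⟩
  have ht0 := ht.1
  have hq : 0 < t / T := div_pos ht0 hT
  have hrpos : 0 < r t := rpow_pos_of_pos hq _
  have hrlt : r t < 2 :=
    (rpow_le_one hq.le ((div_le_one hT).2 ht.2) (by positivity)).trans_lt one_lt_two
  have hr' : HasDerivAt r (r t / (k * t)) t := by
    refine (((hasDerivAt_id t).div_const T).rpow_const (Or.inl hq.ne')).congr_deriv ?_
    simp only [id, rpow_sub_one hq.ne', r]
    field_simp
  have hXr := ((hX (r t) ⟨hrpos.le, hrlt.le⟩).hasDerivAt (Icc_mem_nhds hrpos hrlt)).scomp t hr'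
  have hlogr : k * log (r t) = log (t / T) := by
    rw [log_rpow hq, mul_inv_cancel_left₀ hk.ne']
  have hGr : G (r t) = r t * log (t / T) := by
    rw [← hlogr]
    ring
  have hPr : P (r t) * r t ^ 3 = k * tau p lam t ^ 2 := by
    rw [tau_sq ht0.le, mul_assoc, Finset.sum_mul]
    congr 1
    refine Finset.sum_congr rfl fun i _ ↦ ?_
    have h : r t ^ (k * (2 - 2 * p i) - 3) * r t ^ 3 = (t / T) ^ (2 - 2 * p i) := by
      rw [← rpow_natCast (r t) 3, ← rpow_add hrpos, ← rpow_mul hq.le, Nat.cast_ofNat,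
        sub_add_cancel, inv_mul_cancel_left₀ hk.ne']
    calc _ = T ^ (2 - 2 * p i) * (r t ^ (k * (2 - 2 * p i) - 3) * r t ^ 3) * (lam i : ℝ) ^ 2 := by
          ring
      _ = _ := by
        rw [h, ← mul_rpow hT.le hq.le, mul_div_cancel₀ _ hT.ne']
  have hτ : tau p lam t ^ 2 = P (r t) * r t ^ 3 / k := by
    rw [hPr, mul_div_cancel_left₀ _ hk.ne']
  set L := log (t / T)
  set x := X (r t)
  have hψ : HasDerivAt (fun t ↦ (X (r t)).1) (-(tau p lam t ^ 2) * (x.2 + x.1 * L) / t) t := by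
    refine (F.hasFDerivAt.comp_hasDerivAt t hXr).congr_deriv ?_
    simp [A, F, S, hGr, hτ]
    field_simp
    ring
  have hφ : HasDerivAt (fun t ↦ (X (r t)).2) (tau p lam t ^ 2 * (x.2 + x.1 * L) * L / t) t := by
    refine (S.hasFDerivAt.comp_hasDerivAt t hXr).congr_deriv ?_
    simp [A, F, S, hGr, hτ]
    field_simp
  refine ⟨(hφ.add (hψ.mul (hasDerivAt_log_div hT ht0))).congr_deriv ?_, hψ⟩
  ring

end Wave

/-- Proposition `prop:wave_low_freq_scat`(ii): prescribing asymptotic data (ψ_∞, φ̃_∞) at the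
singularity determines a unique λ-mode wave solution on (0, t_{λ*}], with quantitative rates. -/
theorem wave_low_freq_asymptotic_completeness (D : ℕ) (hD : 2 ≤ D) (p : Fin D → ℝ)
    (hp : ∀ i, p i < 1) :
    ∃ C Clow : ℝ, 0 < C ∧ 0 < Clow ∧
      ∀ (lam : Fin D → ℤ), lam ≠ 0 →
      ∀ tstar : ℝ, 0 < tstar → tstar ≤ 1 → tau p lam tstar = 1 →
      ∀ psiInf phiInf : ℝ,
        ∃ φ ψ : ℝ → ℝ,
          IsWaveSol p lam φ ψ (Set.Ioc 0 tstar) ∧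
          Tendsto ψ (𝓝[>] (0:ℝ)) (𝓝 psiInf) ∧
          Tendsto (phiTilde φ ψ tstar) (𝓝[>] (0:ℝ)) (𝓝 phiInf) ∧
          (∀ φ' ψ' : ℝ → ℝ, IsWaveSol p lam φ' ψ' (Set.Ioc 0 tstar) →
            Tendsto ψ' (𝓝[>] (0:ℝ)) (𝓝 psiInf) →
            Tendsto (phiTilde φ' ψ' tstar) (𝓝[>] (0:ℝ)) (𝓝 phiInf) →
            ∀ t ∈ Set.Ioc (0:ℝ) tstar, φ' t = φ t ∧ ψ' t = ψ t) ∧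
          (∀ t ∈ Set.Ioc (0:ℝ) tstar,
            |ψ t - psiInf| + |phiTilde φ ψ tstar t - phiInf| ≤
              C * (tau p lam t ^ 2 * (1 + Real.log (tstar / t) ^ 2))
                * Real.sqrt (Elow φ ψ tstar tstar)) ∧
          Elow φ ψ tstar tstar ≤ Clow * (psiInf ^ 2 + phiInf ^ 2) := by
  obtain ⟨m, hm, hmp⟩ : ∃ m : ℝ, 0 < m ∧ ∀ i, m ≤ 2 - 2 * p i := by
    obtain ⟨i, -, hi⟩ := Finset.univ.exists_min_image (fun i ↦ 2 - 2 * p i)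
      ⟨(⟨0, by lia⟩ : Fin D), Finset.mem_univ _⟩
    exact ⟨2 - 2 * p i, by linarith [hp i], fun j ↦ hi j (Finset.mem_univ j)⟩
  set κ : ℝ := 2 / m ^ 2 + 1 / 2 with hκ
  have hκ0 : 0 < κ := by positivity
  refine ⟨2 * (√(exp (2 * (2 / m * κ))) * (2 / m * (1 + κ))), exp (2 * (2 / m * κ)),
    by positivity, exp_pos _, fun lam _ T hT _ hτ a b ↦ ?_⟩
  obtain ⟨φ, ψ, h, ha, hb⟩ := exists_isWaveSol_tendsto (lam := lam) hT hm hmp a b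
  have hwT : lowWeight p lam m T T = 2 / m * κ := by
    simp [lowWeight, hτ, div_self hT.ne', hκ]
  refine ⟨φ, ψ, h, ha, hb, fun φ₁ ψ₁ h₁ ha₁ hb₁ t ht ↦
    h₁.eq_of_tendsto h hT hm hmp ha₁ hb₁ ha hb ht, fun t ht ↦ ?_, ?_⟩
  · refine (h.abs_sub_le_of_tendsto hT hm hmp ha hb ht).trans ?_
    have hw : lowWeight p lam m T t ≤
        2 / m * (1 + κ) * (tau p lam t ^ 2 * (1 + log (T / t) ^ 2)) := by
      rw [lowWeight, ← hκ, ← inv_div T t, log_inv, neg_sq]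
      have : log (T / t) ^ 2 + κ ≤ (1 + κ) * (1 + log (T / t) ^ 2) := by
        nlinarith [mul_nonneg hκ0.le (sq_nonneg (log (T / t)))]
      calc _ ≤ 2 / m * (tau p lam t ^ 2 * ((1 + κ) * (1 + log (T / t) ^ 2))) := by gcongr
        _ = _ := by ring
    rw [hwT, sqrt_mul (Elow_nonneg ..)]
    calc _ ≤ 2 * (√(Elow φ ψ T T) * √(exp (2 * (2 / m * κ))) *
          (2 / m * (1 + κ) * (tau p lam t ^ 2 * (1 + log (T / t) ^ 2)))) := by gcongr
      _ = _ := by ring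
  · rw [← hwT]
    exact h.Elow_le_of_tendsto hT hm hmp ha hb ⟨hT, le_rfl⟩
end

section
/- Set p := max_{1≤i≤D} p_i and P := min_{1≤i≤D} p_i. Then: (i) for every λ ∈ ℤ^D \ {0} and every index i with λ_i ≠ 0, t_{λ*} ≤ |λ_i|^{−1/(1−p_i)}; (ii) there is C > 0 depending only on D and the exponents such that t_{λ*}^{−1} ≤ C·⟨λ⟩^{1/(1−p)} for all λ ∈ ℤ^D \ {0}; (iii) there is C > 0 depending only on D and the exponents such that t_{λ*} ≤ C·⟨λ⟩^{−1/(1−P)} for all λ ∈ ℤ^D \ {0}; (iv) there are constants c, C > 0 depending only on D and the exponents such that log(1/t_{λ*}) ≤ C·log⟨λ⟩ and c·log⟨λ⟩ ≤ 1 + log(1/t_{λ*}) for all λ ∈ ℤ^D \ {0}. -/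
open Real Filter MeasureTheory Topology

/-- The Japanese bracket ⟨λ⟩ = (1 + |λ|²)^(1/2) of a frequency λ ∈ ℤ^D. -/
noncomputable def jap {D : ℕ} (lam : Fin D → ℤ) : ℝ :=
  Real.sqrt (1 + ∑ i, ((lam i : ℝ)) ^ 2)

lemma le_rpow_mul_rpow_of_rpow_mul_le {t a x b : ℝ} (ht : 0 < t) (ha : 0 < a) (hx : 0 < x)
    (h : t ^ a * x ≤ b) : t ≤ b ^ (1 / a) * x ^ (-(1 / a)) := by
  have hb : 0 ≤ b := (by positivity : 0 ≤ t ^ a * x).trans h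
  calc t = (t ^ a) ^ (1 / a) := by rw [← rpow_mul ht.le, mul_one_div_cancel ha.ne', rpow_one]
    _ ≤ (b / x) ^ (1 / a) := by
      have := (le_div_iff₀ hx).2 h
      gcongr
    _ = b ^ (1 / a) * x ^ (-(1 / a)) := by
      rw [div_rpow hb hx.le, rpow_neg hx.le, div_eq_mul_inv]

lemma sq_rpow_one_sub {t : ℝ} (ht : 0 < t) (q : ℝ) : (t ^ (1 - q)) ^ 2 = t ^ (2 - 2 * q) := by
  rw [← rpow_natCast, ← rpow_mul ht.le]
  congr 1
  push_cast
  ring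

section

variable {D : ℕ} {p : Fin D → ℝ} {lam : Fin D → ℤ} {t : ℝ}

lemma tau_eq_one_iff :
    tau p lam t = 1 ↔ ∑ i, t ^ (2 - 2 * p i) * (lam i : ℝ) ^ 2 = 1 :=
  Real.sqrt_eq_one

lemma jap_sq (lam : Fin D → ℤ) : jap lam ^ 2 = 1 + ∑ i, (lam i : ℝ) ^ 2 :=
  Real.sq_sqrt (by positivity)

lemma one_le_sum_sq (hlam : lam ≠ 0) : 1 ≤ ∑ i, (lam i : ℝ) ^ 2 := by
  obtain ⟨i, hi⟩ := Function.ne_iff.1 hlam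
  have h : (1 : ℝ) ≤ (lam i : ℝ) ^ 2 := by
    exact_mod_cast Int.add_one_le_of_lt (sq_pos_of_ne_zero hi)
  exact h.trans (Finset.single_le_sum (f := fun i => (lam i : ℝ) ^ 2)
    (fun _ _ => sq_nonneg _) (Finset.mem_univ i))

lemma one_le_jap (lam : Fin D → ℤ) : 1 ≤ jap lam :=
  Real.one_le_sqrt.2 (le_add_of_nonneg_right (by positivity))

lemma rpow_mul_abs_le_one (ht : 0 < t) (h : tau p lam t = 1) (i : Fin D) :
    t ^ (1 - p i) * |(lam i : ℝ)| ≤ 1 := by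
  rw [← sq_le_one_iff₀ (by positivity), mul_pow, sq_abs, sq_rpow_one_sub ht,
    ← tau_eq_one_iff.1 h]
  exact Finset.single_le_sum (f := fun i => t ^ (2 - 2 * p i) * (lam i : ℝ) ^ 2)
    (fun _ _ => by positivity) (Finset.mem_univ i)

lemma one_le_rpow_mul_jap {q : ℝ} (hq : ∀ i, p i ≤ q) (ht : 0 < t) (ht1 : t ≤ 1)
    (h : tau p lam t = 1) : 1 ≤ t ^ (1 - q) * jap lam := by
  have := one_le_jap lam
  rw [← one_le_sq_iff₀ (by positivity), mul_pow, sq_rpow_one_sub ht, jap_sq]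
  calc (1 : ℝ) = ∑ i, t ^ (2 - 2 * p i) * (lam i : ℝ) ^ 2 := (tau_eq_one_iff.1 h).symm
    _ ≤ ∑ i, t ^ (2 - 2 * q) * (lam i : ℝ) ^ 2 := by
      refine Finset.sum_le_sum fun i _ => mul_le_mul_of_nonneg_right ?_ (sq_nonneg _)
      exact rpow_le_rpow_of_exponent_ge ht ht1 (by linarith [hq i])
    _ ≤ t ^ (2 - 2 * q) * (1 + ∑ i, (lam i : ℝ) ^ 2) := by
      rw [← Finset.mul_sum]
      exact mul_le_mul_of_nonneg_left (by linarith) (by positivity)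

lemma rpow_mul_jap_le {q : ℝ} (hq : ∀ i, q ≤ p i) (hlam : lam ≠ 0) (ht : 0 < t) (ht1 : t ≤ 1)
    (h : tau p lam t = 1) : t ^ (1 - q) * jap lam ≤ √2 := by
  refine Real.le_sqrt_of_sq_le ?_
  rw [mul_pow, sq_rpow_one_sub ht, jap_sq]
  calc t ^ (2 - 2 * q) * (1 + ∑ i, (lam i : ℝ) ^ 2)
      ≤ t ^ (2 - 2 * q) * (2 * ∑ i, (lam i : ℝ) ^ 2) :=
        mul_le_mul_of_nonneg_left (by linarith [one_le_sum_sq hlam]) (by positivity)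
    _ = 2 * ∑ i, t ^ (2 - 2 * q) * (lam i : ℝ) ^ 2 := by rw [← Finset.mul_sum]; ring
    _ ≤ 2 * ∑ i, t ^ (2 - 2 * p i) * (lam i : ℝ) ^ 2 := by
      refine mul_le_mul_of_nonneg_left (Finset.sum_le_sum fun i _ =>
        mul_le_mul_of_nonneg_right ?_ (sq_nonneg _)) two_pos.le
      exact rpow_le_rpow_of_exponent_ge ht ht1 (by linarith [hq i])
    _ = 2 := by rw [tau_eq_one_iff.1 h, mul_one]

lemma inv_le_jap_rpow {q : ℝ} (hq1 : q < 1) (hq : ∀ i, p i ≤ q) (ht : 0 < t) (ht1 : t ≤ 1)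
    (h : tau p lam t = 1) : t⁻¹ ≤ jap lam ^ (1 / (1 - q)) := by
  have h1 : t⁻¹ ^ (1 - q) * 1 ≤ jap lam := by
    rw [mul_one, inv_rpow ht.le, inv_le_iff_one_le_mul₀' (by positivity)]
    exact one_le_rpow_mul_jap hq ht ht1 h
  simpa using le_rpow_mul_rpow_of_rpow_mul_le (inv_pos.2 ht) (sub_pos.2 hq1) one_pos h1

end

/-- Lemma `lem:tstar`: growth rates of t_{λ*} in terms of the frequency λ, where
p = max pᵢ and P = min pᵢ. -/
theorem tstar_growth_rates (D : ℕ) (hD : 2 ≤ D) (p : Fin D → ℝ) (hp : ∀ i, p i < 1) :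
    (∀ (lam : Fin D → ℤ), lam ≠ 0 →
      ∀ tstar : ℝ, 0 < tstar → tstar ≤ 1 → tau p lam tstar = 1 →
      ∀ i : Fin D, lam i ≠ 0 →
        tstar ≤ |(lam i : ℝ)| ^ (-(1 / (1 - p i)))) ∧
    (∃ C : ℝ, 0 < C ∧
      ∀ (lam : Fin D → ℤ), lam ≠ 0 →
      ∀ tstar : ℝ, 0 < tstar → tstar ≤ 1 → tau p lam tstar = 1 →
        tstar⁻¹ ≤ C * jap lam ^ (1 / (1 - sSup (Set.range p)))) ∧
    (∃ C : ℝ, 0 < C ∧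
      ∀ (lam : Fin D → ℤ), lam ≠ 0 →
      ∀ tstar : ℝ, 0 < tstar → tstar ≤ 1 → tau p lam tstar = 1 →
        tstar ≤ C * jap lam ^ (-(1 / (1 - sInf (Set.range p))))) ∧
    (∃ c C : ℝ, 0 < c ∧ 0 < C ∧
      ∀ (lam : Fin D → ℤ), lam ≠ 0 →
      ∀ tstar : ℝ, 0 < tstar → tstar ≤ 1 → tau p lam tstar = 1 →
        Real.log (1 / tstar) ≤ C * Real.log (jap lam) ∧
        c * Real.log (jap lam) ≤ 1 + Real.log (1 / tstar)) := by
  have : Nonempty (Fin D) := ⟨⟨0, by omega⟩⟩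
  have hfin := Set.finite_range p
  have hmax : ∀ i, p i ≤ sSup (Set.range p) := fun i => le_csSup hfin.bddAbove ⟨i, rfl⟩
  have hmin : ∀ i, sInf (Set.range p) ≤ p i := fun i => csInf_le hfin.bddBelow ⟨i, rfl⟩
  have hmax1 : sSup (Set.range p) < 1 :=
    (hfin.csSup_lt_iff (Set.range_nonempty p)).2 (Set.forall_mem_range.2 hp)
  have hmin1 : sInf (Set.range p) < 1 := (hmin ⟨0, by omega⟩).trans_lt (hp _)
  generalize sSup (Set.range p) = q at *
  generalize sInf (Set.range p) = r at *
  refine ⟨fun lam _ t ht _ h i hi => ?_, ⟨1, one_pos, fun lam _ t ht ht1 h => ?_⟩,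
    ⟨√2 ^ (1 / (1 - r)), by positivity, fun lam hlam t ht ht1 h => ?_⟩,
    ⟨1 / (2 - r), 1 / (1 - q), one_div_pos.2 (by linarith), one_div_pos.2 (by linarith),
      fun lam hlam t ht ht1 h => ⟨?_, ?_⟩⟩⟩
  · simpa using le_rpow_mul_rpow_of_rpow_mul_le ht (sub_pos.2 (hp i))
      (abs_pos.2 (Int.cast_ne_zero.2 hi)) (rpow_mul_abs_le_one ht h i)
  · rw [one_mul]
    exact inv_le_jap_rpow hmax1 hmax ht ht1 h
  · exact le_rpow_mul_rpow_of_rpow_mul_le ht (sub_pos.2 hmin1)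
      (one_pos.trans_le (one_le_jap lam)) (rpow_mul_jap_le hmin hlam ht ht1 h)
  · rw [← log_rpow (one_pos.trans_le (one_le_jap lam)), one_div t]
    exact log_le_log (inv_pos.2 ht) (inv_le_jap_rpow hmax1 hmax ht ht1 h)
  · have hj : 0 < jap lam := one_pos.trans_le (one_le_jap lam)
    have hlog := log_le_log (by positivity) (rpow_mul_jap_le hmin hlam ht ht1 h)
    rw [log_mul (by positivity) hj.ne', log_rpow ht, log_sqrt two_pos.le] at hlog
    have hlog_t := log_nonpos ht.le ht1
    rw [one_div_mul_eq_div, div_le_iff₀ (by linarith), one_div, log_inv]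
    nlinarith [log_two_lt_d9]
end
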